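/- Let n ≥ 3 be odd, C_n = v₀v₁⋯v_{n-1}v₀ the n-cycle, and for 1 ≤ k ≤ (n-3)/2 and 1 ≤ i₁ ≤ ⋯ ≤ i_k ≤ (n-3)/2 let H(i₁,…,i_k) = C_n + v_{i₁}v_{n-i₁} + ⋯ + v_{i_k}v_{n-i_k}. If G is a nonbipartite 2-connected graph of order n with q(G) = q(C_n), then G ≅ C_n or G ≅ H(i₁,…,i_k) for some such indices. -/

import Mathlib

open Matrix SimpleGraph
open scoped Classical

/-- The signless Laplacian matrix `Q(G) = D(G) + A(G)` of a simple graph. -/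
noncomputable def signlessLaplacian {V : Type*} [Fintype V] (G : SimpleGraph V) :
    Matrix V V ℝ := fun i j =>
  (if i = j then ((G.neighborSet i).ncard : ℝ) else 0) + (if G.Adj i j then 1 else 0)

/-- The least eigenvalue `q(G)` of the signless Laplacian of `G`. -/
noncomputable def leastQEig {V : Type*} [Fintype V] (G : SimpleGraph V) : ℝ :=
  sInf {μ : ℝ | ∃ x : V → ℝ, x ≠ 0 ∧ (signlessLaplacian G).mulVec x = μ • x}

/-- A graph is 2-connected if it has at least 3 vertices and no cut vertex. -/
def TwoConnected {V : Type*} [Fintype V] (G : SimpleGraph V) : Prop :=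
  3 ≤ Fintype.card V ∧
    ∀ v : V, (((⊤ : G.Subgraph).deleteVerts {v}).coe).Connected

/-- The cycle `C_n` on vertices `v_0, …, v_{n-1}`. -/
def cycleG (n : ℕ) : SimpleGraph (Fin n) :=
  SimpleGraph.fromRel (fun i j => (i.val + 1) % n = j.val)

/-- `H(i₁,…,i_k)`: the cycle `C_n` together with the chords `v_i v_{n-i}` for `i ∈ S`. -/
def Hgraph (n : ℕ) (S : Finset ℕ) : SimpleGraph (Fin n) :=
  cycleG n ⊔ SimpleGraph.fromRel (fun a b => ∃ i ∈ S, a.val = i ∧ b.val = n - i)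

/-- `Θ(j,k)`: the odd cycle `v₁v₂⋯v_{n-1}v₁` plus a vertex `v₀` adjacent to `v_j` and `v_k`. -/
def thetaJK (n j k : ℕ) : SimpleGraph (Fin n) :=
  SimpleGraph.fromRel (fun a b =>
    (1 ≤ a.val ∧ b.val = a.val + 1) ∨ (a.val = 1 ∧ b.val = n - 1) ∨
      (a.val = 0 ∧ (b.val = j ∨ b.val = k)))

/-- The graph `Θ = Θ(2, n-1)`. -/
def thetaG (n : ℕ) : SimpleGraph (Fin n) := thetaJK n 2 (n - 1)

noncomputable section Core

/-- coefficient of the gap `i` in the edge `p q` -/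
def cf (x : ℕ → ℝ) (p q i : ℕ) : ℝ :=
  (if p ≤ i then 1 else 0) + (if (0 ≤ x p ↔ 0 ≤ x q) then 1 else -1) * (if q ≤ i then 1 else 0)

/-- ordered edges -/
def PE (n : ℕ) (A : ℕ → ℕ → Prop) : Finset (ℕ × ℕ) :=
  ((Finset.range n) ×ˢ (Finset.range n)).filter (fun e => e.1 < e.2 ∧ A e.1 e.2)

def En (n : ℕ) (A : ℕ → ℕ → Prop) (x : ℕ → ℝ) : ℝ :=
  ∑ e ∈ PE n A, (x e.1 + x e.2) ^ 2

def Mm (n : ℕ) (A : ℕ → ℕ → Prop) (x : ℕ → ℝ) (i j : ℕ) : ℝ :=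
  ∑ e ∈ PE n A, cf x e.1 e.2 i * cf x e.1 e.2 j

/-- the target coefficients -/
def Bm (n i j : ℕ) : ℝ :=
  if i = j then (if i + 1 = n then 4 else 2)
  else if j = i + 1 ∨ i = j + 1 then (if i + 1 = n ∨ j + 1 = n then 2 else 1) else 0

/-- energy of the folded cycle -/
def ET (n : ℕ) (a : ℕ → ℝ) : ℝ :=
  (a 0 - a 1) ^ 2 + ∑ i ∈ Finset.range (n - 2), (a i - a (i + 2)) ^ 2 + (a (n - 2) + a (n - 1)) ^ 2

/-- Two-connectedness and nonbipartiteness, in terms of natural number labels -/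
structure Gd (n : ℕ) (A : ℕ → ℕ → Prop) : Prop where
  hn : 3 ≤ n
  symm : ∀ p q, A p q → A q p
  irr : ∀ p, ¬ A p p
  lt : ∀ p q, A p q → p < n
  K : ∀ (v : ℕ) (U : ℕ → Prop), (∃ u, U u ∧ u < n ∧ u ≠ v) → (∃ u, ¬ U u ∧ u < n ∧ u ≠ v) →
    ∃ p q, U p ∧ ¬ U q ∧ p ≠ v ∧ q ≠ v ∧ A p q
  nb : ∀ c : ℕ → Prop, ∃ p q, A p q ∧ (c p ↔ c q)

/-- Sorted vectors -/
structure Srt (n : ℕ) (x a : ℕ → ℝ) : Prop where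
  abs : ∀ i, a i = |x i|
  anti : Antitone a
  zero : ∀ i, n ≤ i → a i = 0

lemma mem_PE {n : ℕ} {A : ℕ → ℕ → Prop} (h : Gd n A) {p q : ℕ} :
    (p, q) ∈ PE n A ↔ p < q ∧ A p q := by
  simp only [PE, Finset.mem_filter, Finset.mem_product, Finset.mem_range]
  constructor
  · tauto
  · intro hh
    exact ⟨⟨h.lt _ _ hh.2, h.lt _ _ (h.symm _ _ hh.2)⟩, hh⟩

lemma telesc (n : ℕ) (a : ℕ → ℝ) (hz : ∀ i, n ≤ i → a i = 0) (p : ℕ) :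
    ∑ i ∈ Finset.range n, (if p ≤ i then (1 : ℝ) else 0) * (a i - a (i + 1)) = a p := by
  have key : ∀ m, ∑ i ∈ Finset.range m, (if p ≤ i then (1 : ℝ) else 0) * (a i - a (i + 1))
      = if p ≤ m then a p - a m else 0 := by
    intro m
    induction m with
    | zero => 
      by_cases hp : p = 0
      · simp [hp]
      · simp [hp]
    | succ m ih =>
      rw [Finset.sum_range_succ, ih]
      by_cases h1 : p ≤ m
      · have : p ≤ m + 1 := by omega
        simp [h1, this]
      · by_cases h2 : p = m + 1
        · simp [h2]
        · have : ¬ p ≤ m + 1 := by omega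
          simp [h1, this]
  rw [key, hz n le_rfl]
  split_ifs with h
  · simp
  · rw [hz p (by omega)]

lemma edge_sq {n : ℕ} {x a : ℕ → ℝ} (h : Srt n x a) (p q : ℕ) :
    (x p + x q) ^ 2 = (∑ i ∈ Finset.range n, cf x p q i * (a i - a (i + 1))) ^ 2 := by
  have : ∑ i ∈ Finset.range n, cf x p q i * (a i - a (i + 1)) =
      a p + (if (0 ≤ x p ↔ 0 ≤ x q) then 1 else -1) * a q := by
    rw [← telesc n a h.zero p]
    conv_rhs => rw [← telesc n a h.zero q]
    rw [Finset.mul_sum, telesc n a h.zero p, ← telesc n a h.zero p, ← Finset.sum_add_distrib]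
    refine Finset.sum_congr rfl fun i _ => ?_
    simp only [cf]; ring
  rw [this, h.abs, h.abs]
  rcases le_or_gt 0 (x p) with hp | hp <;> rcases le_or_gt 0 (x q) with hq | hq
  · simp [hp, hq, abs_of_nonneg]
  · simp [hp, hq, not_le.2 hq, abs_of_nonneg, abs_of_neg]
  · simp only [not_le.2 hp, hq, abs_of_nonneg, abs_of_neg hp, false_iff, not_true, if_false]
    ring
  · simp only [not_le.2 hp, not_le.2 hq, abs_of_neg hq, abs_of_neg hp, if_true]
    ring

lemma En_eq {n : ℕ} {A : ℕ → ℕ → Prop} {x a : ℕ → ℝ} (h : Srt n x a) :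
    En n A x = ∑ i ∈ Finset.range n, ∑ j ∈ Finset.range n,
      Mm n A x i j * ((a i - a (i + 1)) * (a j - a (j + 1))) := by
  simp only [En, Mm]
  simp_rw [edge_sq h, sq, Finset.sum_mul_sum, Finset.sum_mul]
  rw [Finset.sum_comm]
  refine Finset.sum_congr rfl fun i _ => ?_
  rw [Finset.sum_comm]
  refine Finset.sum_congr rfl fun j _ => ?_
  refine Finset.sum_congr rfl fun e _ => ?_
  ring


lemma ET_eq {n : ℕ} (hn : 3 ≤ n) {a : ℕ → ℝ} (hz : ∀ i, n ≤ i → a i = 0) :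
    ET n a = ∑ i ∈ Finset.range n, ∑ j ∈ Finset.range n,
      Bm n i j * ((a i - a (i + 1)) * (a j - a (j + 1))) := by
  obtain ⟨k, rfl⟩ : ∃ k, n = k + 2 := ⟨n - 2, by omega⟩
  set e : ℕ → ℝ := fun i => a i - a (i + 1) with he
  have hlast : a (k + 1) = e (k + 1) := by simp [he, hz (k+2) le_rfl]
  have hB : ∀ i ∈ Finset.range (k + 2), ∀ j ∈ Finset.range (k + 2), Bm (k + 2) i j * (e i * e j) =
      (if i = j then 2 * e i ^ 2 else 0) + (if i + 1 = j then e i * e (i + 1) else 0) +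
      (if j + 1 = i then e j * e (j + 1) else 0)
      + (if k + 1 = j then (if i = k + 1 then 2 * e (k + 1) ^ 2 else 0) else 0)
      + (if k + 1 = j then (if i = k then e k * e (k + 1) else 0) else 0)
      + (if k = j then (if i = k + 1 then e k * e (k + 1) else 0) else 0)
      := by
    intro i hi j hj
    rw [Finset.mem_range] at hi hj
    unfold Bm
    by_cases h1 : i = j
    · subst h1
      by_cases h2 : i = k + 1
      · subst h2; simp; ring
      · have h3 : ¬ k + 1 = i := by omega
        have h4 : ¬ i = i + 1 := by omega
        by_cases h5 : i = k
        · subst h5; simp; ring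
        · simp [h2, h3]
          ring
    · by_cases h2 : j = i + 1
      · subst h2
        have h6 : ¬ i + 1 + 1 = i := by omega
        have h7 : ¬ i = k + 1 := by omega
        by_cases h3 : i = k
        · subst h3
          simp [h6]
          ring
        · have h8 : ¬ k = i := by omega
          simp [h3, h6, h7, h8]
      · by_cases h4 : i = j + 1
        · subst h4
          have h6 : ¬ j + 1 + 1 = j := by omega
          have h7 : ¬ j = k + 1 := by omega
          have h9 : ¬ k + 1 = j := by omega
          by_cases h3 : j = k
          · subst h3
            simp [h6]
            ring
          · have h8 : ¬ k = j := by omega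
            simp [h3, h6, h7, h8, h9]
            ring
        · have h5 : ¬ i + 1 = j := by omega
          have h6 : ¬ j + 1 = i := by omega
          rw [if_neg h1, if_neg (by omega), if_neg h1, if_neg h5, if_neg h6]
          have h7 : ¬ (k + 1 = j ∧ i = k + 1) := by omega
          have h8 : ¬ (k + 1 = j ∧ i = k) := by omega
          have h9 : ¬ (k = j ∧ i = k + 1) := by omega
          simp only [← ite_and, if_neg h7, if_neg h8, if_neg h9]
          ring
  have hR : ∑ i ∈ Finset.range (k + 2), ∑ j ∈ Finset.range (k + 2), Bm (k + 2) i j * (e i * e j) =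
      ∑ i ∈ Finset.range (k + 2), 2 * e i ^ 2 + ∑ i ∈ Finset.range (k + 1), e i * e (i + 1)
      + ∑ i ∈ Finset.range (k + 1), e i * e (i + 1) + 2 * e (k + 1) ^ 2 + e k * e (k + 1)
      + e k * e (k + 1) := by
    rw [Finset.sum_congr rfl fun i hi => Finset.sum_congr rfl fun j hj => hB i hi j hj]
    simp only [Finset.sum_add_distrib]
    have h1 : ∑ i ∈ Finset.range (k + 2), ∑ j ∈ Finset.range (k + 2),
        (if i + 1 = j then e i * e (i + 1) else 0) = ∑ i ∈ Finset.range (k + 1), e i * e (i + 1) := by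
      rw [Finset.sum_range_succ]
      rw [Finset.sum_eq_zero (s := Finset.range (k + 2))
        (f := fun j => if k + 1 + 1 = j then e (k + 1) * e (k + 1 + 1) else 0), add_zero]
      · refine Finset.sum_congr rfl fun i hi => ?_
        rw [Finset.mem_range] at hi
        rw [Finset.sum_ite_eq, if_pos]
        rw [Finset.mem_range]; omega
      · intro j hj
        rw [Finset.mem_range] at hj
        rw [if_neg (by omega)]
    have h2 : ∑ i ∈ Finset.range (k + 2), ∑ j ∈ Finset.range (k + 2),
        (if j + 1 = i then e j * e (j + 1) else 0) = ∑ i ∈ Finset.range (k + 1), e i * e (i + 1) := by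
      rw [Finset.sum_comm]; exact h1
    rw [h1, h2]
    congr 1
    congr 1
    congr 1
    · congr 1
      congr 1
      refine Finset.sum_congr rfl fun i hi => ?_
      rw [Finset.sum_ite_eq, if_pos hi]
    · simp
    · simp
    · simp
  rw [hR]
  simp only [ET, Nat.add_sub_cancel, show k + 2 - 1 = k + 1 by omega]
  have h3 : ∀ i, a i - a (i + 2) = e i + e (i + 1) := by intro i; simp [he]
  have h4 : a k = e k + e (k + 1) := by rw [← hlast]; simp [he]
  simp only [h3]
  rw [h4, hlast]
  have h5 : ∀ m, e 0 ^ 2 + ∑ i ∈ Finset.range m, (e i + e (i + 1)) ^ 2 + e m ^ 2 =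
    ∑ i ∈ Finset.range (m + 1), 2 * e i ^ 2 + 2 * ∑ i ∈ Finset.range m, e i * e (i + 1) := by
    intro m
    induction m with
    | zero => simp; ring
    | succ m ih =>
      rw [Finset.sum_range_succ, Finset.sum_range_succ (n := m + 1), 
        Finset.sum_range_succ (f := fun i => e i * e (i + 1))]
      linear_combination ih
  have h6 := h5 k
  rw [Finset.sum_range_succ, Finset.sum_range_succ (f := fun i => e i * e (i + 1))]
  change e 0 ^ 2 + _ + _ = _
  linear_combination h6

lemma cf_cross {x : ℕ → ℝ} {p q i : ℕ} (h1 : p ≤ i) (h2 : i < q) : cf x p q i = 1 := by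
  simp [cf, h1, not_le.2 h2]

lemma cf_same {x : ℕ → ℝ} {p q i : ℕ} (h : 0 ≤ x p ↔ 0 ≤ x q) (h1 : p < q) (h2 : q ≤ i) :
    cf x p q i = 2 := by
  have : p ≤ i := by omega
  simp [cf, h2, this, h]; norm_num

lemma cf_nonneg {x : ℕ → ℝ} {p q : ℕ} (i : ℕ) (h : p < q) : 0 ≤ cf x p q i := by
  unfold cf
  split_ifs <;> first | omega | norm_num

lemma cf_same_pos {x : ℕ → ℝ} {p q i : ℕ} (h : 0 ≤ x p ↔ 0 ≤ x q) (h1 : p ≤ i) :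
    1 ≤ cf x p q i := by
  simp only [cf, h1, h, if_true]
  split_ifs <;> norm_num

lemma PE_nonneg {n : ℕ} {A : ℕ → ℕ → Prop} (x : ℕ → ℝ) (i j : ℕ) :
    ∀ e ∈ PE n A, 0 ≤ cf x e.1 e.2 i * cf x e.1 e.2 j := by
  intro e he
  simp only [PE, Finset.mem_filter] at he
  exact mul_nonneg (cf_nonneg _ he.2.1) (cf_nonneg _ he.2.1)

lemma Mm_ge_one {n : ℕ} {A : ℕ → ℕ → Prop} (h : Gd n A) (x : ℕ → ℝ) (i j : ℕ) {p q : ℕ}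
    (hpq : p < q) (hA : A p q) : cf x p q i * cf x p q j ≤ Mm n A x i j :=
  Finset.single_le_sum (f := fun e => cf x e.1 e.2 i * cf x e.1 e.2 j) (PE_nonneg x i j)
    ((mem_PE h).2 ⟨hpq, hA⟩)

lemma Mm_symm (n : ℕ) (A : ℕ → ℕ → Prop) (x : ℕ → ℝ) (i j : ℕ) : Mm n A x i j = Mm n A x j i :=
  Finset.sum_congr rfl fun _ _ => mul_comm _ _

lemma Mm_nonneg (n : ℕ) (A : ℕ → ℕ → Prop) (x : ℕ → ℝ) (i j : ℕ) : 0 ≤ Mm n A x i j :=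
  Finset.sum_nonneg (PE_nonneg x i j)

lemma Mm_ge_card {n : ℕ} {A : ℕ → ℕ → Prop} (h : Gd n A) (x : ℕ → ℝ) (i : ℕ) (s : Finset (ℕ × ℕ))
    (hs : ∀ e ∈ s, e.1 ≤ i ∧ i < e.2 ∧ A e.1 e.2) : (s.card : ℝ) ≤ Mm n A x i i := by
  have hsub : s ⊆ PE n A := by
    intro e he
    obtain ⟨h1, h2, h3⟩ := hs e he
    exact (mem_PE h).2 ⟨by omega, h3⟩
  calc (s.card : ℝ) = ∑ e ∈ s, cf x e.1 e.2 i * cf x e.1 e.2 i := by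
        rw [Finset.card_eq_sum_ones, Nat.cast_sum]
        refine Finset.sum_congr rfl fun e he => ?_
        obtain ⟨h1, h2, h3⟩ := hs e he
        rw [cf_cross h1 h2]; norm_num
    _ ≤ _ := Finset.sum_le_sum_of_subset_of_nonneg hsub fun e he _ => PE_nonneg x i i e he

/-- cut edge avoiding a vertex -/
lemma Gd.cut {n : ℕ} {A : ℕ → ℕ → Prop} (h : Gd n A) (v i : ℕ) (u u' : ℕ) (h1 : u ≤ i) (h2 : u ≠ v)
    (h3 : i < u') (h4 : u' ≠ v) (h5 : u' < n) :
    ∃ p q, p ≤ i ∧ i < q ∧ p ≠ v ∧ q ≠ v ∧ A p q ∧ q < n := by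
  obtain ⟨p, q, hp, hq, hpv, hqv, hA⟩ := h.K v (fun u => u ≤ i) ⟨u, h1, by omega, h2⟩
    ⟨u', by omega, h5, h4⟩
  exact ⟨p, q, hp, by omega, hpv, hqv, hA, h.lt _ _ (h.symm _ _ hA)⟩

lemma Gd.same {n : ℕ} {A : ℕ → ℕ → Prop} (h : Gd n A) (x : ℕ → ℝ) :
    ∃ p q, p < q ∧ q < n ∧ A p q ∧ (0 ≤ x p ↔ 0 ≤ x q) := by
  obtain ⟨p, q, hA, hc⟩ := h.nb (fun i => 0 ≤ x i)
  rcases lt_trichotomy p q with h1 | h1 | h1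
  · exact ⟨p, q, h1, h.lt _ _ (h.symm _ _ hA), hA, hc⟩
  · subst h1; exact absurd hA (h.irr _)
  · exact ⟨q, p, h1, h.lt _ _ hA, h.symm _ _ hA, hc.symm⟩

lemma Bm_le {n : ℕ} {A : ℕ → ℕ → Prop} (h : Gd n A) (x : ℕ → ℝ) {i j : ℕ} (hi : i < n) (hj : j < n) :
    Bm n i j ≤ Mm n A x i j := by
  have hn := h.hn
  obtain ⟨p, q, hpq, hq, hA, hs⟩ := h.same x
  have hadj : ∀ i, i + 1 < n → (if i + 2 = n then 2 else 1) ≤ Mm n A x i (i + 1) := by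
    intro i hi
    split_ifs with h1
    · have h2 := Mm_ge_one h x i (i + 1) hpq hA
      rw [cf_same hs hpq (i := i + 1) (by omega)] at h2
      have h3 : 1 ≤ cf x p q i := cf_same_pos hs (by omega)
      linarith
    · obtain ⟨p', q', hp', hq', hpv, hqv, hA', _⟩ := h.cut (i + 1) i i (i + 2) le_rfl (by omega) (by omega)
        (by omega) (by omega)
      have h2 := Mm_ge_one h x i (i + 1) (by omega) hA'
      rw [cf_cross hp' hq', cf_cross (i := i + 1) (by omega) (by omega)] at h2
      linarith
  unfold Bm
  by_cases h1 : i = j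
  · subst h1
    rw [if_pos rfl]
    split_ifs with h2
    · have h2 := Mm_ge_one h x i i hpq hA
      rw [cf_same hs hpq (i := i) (by omega)] at h2
      linarith
    · have : ∃ p1 q1 p2 q2, p1 ≤ i ∧ i < q1 ∧ A p1 q1 ∧ p2 ≤ i ∧ i < q2 ∧ A p2 q2 ∧
          (p1 ≠ p2 ∨ q1 ≠ q2) := by
        by_cases h3 : 1 ≤ i
        · obtain ⟨p1, q1, ha, hb, hc, hd, he, hf⟩ := h.cut i i 0 (i + 1) (by omega) (by omega)
            (by omega) (by omega) (by omega)
          obtain ⟨p2, q2, ha', hb', hc', hd', he', hf'⟩ := h.cut p1 i i (i + 1) (by omega) (by omega)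
            (by omega) (by omega) (by omega)
          exact ⟨p1, q1, p2, q2, ha, hb, he, ha', hb', he', Or.inl (Ne.symm hc')⟩
        · have h3 : i = 0 := by omega
          subst h3
          obtain ⟨p1, q1, ha, hb, hc, hd, he, hf⟩ := h.cut 1 0 0 2 (by omega) (by omega)
            (by omega) (by omega) (by omega)
          obtain ⟨p2, q2, ha', hb', hc', hd', he', hf'⟩ := h.cut q1 0 0 1 (by omega) (by omega)
            (by omega) (by omega) (by omega)
          exact ⟨p1, q1, p2, q2, ha, hb, he, ha', hb', he', Or.inr (Ne.symm hd')⟩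
      obtain ⟨p1, q1, p2, q2, ha, hb, hc, ha', hb', hc', hne⟩ := this
      have h4 := Mm_ge_card h x i {(p1, q1), (p2, q2)} (by
        intro e he
        simp only [Finset.mem_insert, Finset.mem_singleton] at he
        rcases he with rfl | rfl
        · exact ⟨ha, hb, hc⟩
        · exact ⟨ha', hb', hc'⟩)
      rw [Finset.card_pair (by simp only [ne_eq, Prod.mk.injEq]; tauto)] at h4
      exact_mod_cast h4
  · rw [if_neg h1]
    by_cases h2 : j = i + 1
    · subst h2
      have h3 := hadj i hj
      rw [if_pos (Or.inl rfl)]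
      convert h3 using 1
      congr 1
      apply propext; omega
    · by_cases h3 : i = j + 1
      · subst h3
        have h4 := hadj j hi
        rw [if_pos (Or.inr rfl), Mm_symm]
        convert h4 using 1
        congr 1
        apply propext; omega
      · rw [if_neg (by omega)]
        exact Mm_nonneg _ _ _ _ _

lemma ET_le {n : ℕ} {A : ℕ → ℕ → Prop} (h : Gd n A) {x a : ℕ → ℝ} (hs : Srt n x a) :
    ET n a ≤ En n A x := by
  rw [ET_eq h.hn hs.zero, En_eq hs]
  refine Finset.sum_le_sum fun i hi => Finset.sum_le_sum fun j hj => ?_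
  rw [Finset.mem_range] at hi hj
  refine mul_le_mul_of_nonneg_right (Bm_le h x hi hj) (mul_nonneg ?_ ?_)
  · linarith [hs.anti (Nat.le_succ i)]
  · linarith [hs.anti (Nat.le_succ j)]

lemma Mm_eq {n : ℕ} {A : ℕ → ℕ → Prop} (h : Gd n A) {x a : ℕ → ℝ} (hs : Srt n x a)
    (heq : En n A x ≤ ET n a) {i j : ℕ} (hi : i < n) (hj : j < n)
    (hi' : a (i + 1) < a i) (hj' : a (j + 1) < a j) : Mm n A x i j = Bm n i j := by
  by_contra hne
  have hlt : Bm n i j < Mm n A x i j := lt_of_le_of_ne (Bm_le h x hi hj) (Ne.symm hne)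
  apply absurd heq
  rw [not_le, ET_eq h.hn hs.zero, En_eq hs]
  have hle : ∀ i ∈ Finset.range n, ∀ j ∈ Finset.range n, 
      Bm n i j * ((a i - a (i + 1)) * (a j - a (j + 1))) ≤
      Mm n A x i j * ((a i - a (i + 1)) * (a j - a (j + 1))) := by
    intro i hi j hj
    rw [Finset.mem_range] at hi hj
    refine mul_le_mul_of_nonneg_right (Bm_le h x hi hj) (mul_nonneg ?_ ?_)
    · linarith [hs.anti (Nat.le_succ i)]
    · linarith [hs.anti (Nat.le_succ j)]
  refine Finset.sum_lt_sum (fun i hi => Finset.sum_le_sum (hle i hi)) ⟨i, Finset.mem_range.2 hi, ?_⟩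
  refine Finset.sum_lt_sum (hle i (Finset.mem_range.2 hi)) ⟨j, Finset.mem_range.2 hj, ?_⟩
  exact mul_lt_mul_of_pos_right hlt (mul_pos (by linarith) (by linarith))

/-- Structure facts -/
structure Fct (n : ℕ) (A : ℕ → ℕ → Prop) (x a : ℕ → ℝ) : Prop where
  jump : ∀ i j p q, i + 2 ≤ j → j < n → a (i + 1) < a i → a (j + 1) < a j → p ≤ i → p < q → A p q →
    q ≤ j
  same : ∀ i j p q, i + 2 ≤ j → j < n → a (i + 1) < a i → a (j + 1) < a j → p < q → A p q →
    (0 ≤ x p ↔ 0 ≤ x q) → i < p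
  three : ∀ i p1 q1 p2 q2 p3 q3, i + 1 < n → a (i + 1) < a i → p1 ≤ i → i < q1 → A p1 q1 →
    p2 ≤ i → i < q2 → A p2 q2 → p3 ≤ i → i < q3 → A p3 q3 →
    (p1 = p2 ∧ q1 = q2) ∨ (p1 = p3 ∧ q1 = q3) ∨ (p2 = p3 ∧ q2 = q3)

lemma facts {n : ℕ} {A : ℕ → ℕ → Prop} (h : Gd n A) {x a : ℕ → ℝ} (hs : Srt n x a)
    (heq : En n A x ≤ ET n a) : Fct n A x a := by
  have hfar : ∀ i j, i + 2 ≤ j → Bm n i j = 0 := by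
    intro i j hij
    rw [Bm, if_neg (by omega), if_neg (by omega)]
  constructor
  · intro i j p q hij hj hi' hj' hp hpq hA
    by_contra hq
    have h1 := Mm_eq h hs heq (by omega) hj hi' hj'
    have h2 := Mm_ge_one h x i j hpq hA
    rw [h1, hfar i j hij, cf_cross hp (by omega), cf_cross (by omega) (by omega)] at h2
    linarith
  · intro i j p q hij hj hi' hj' hpq hA hsm
    by_contra hp
    have h1 := Mm_eq h hs heq (by omega) hj hi' hj'
    have h2 := Mm_ge_one h x i j hpq hA
    rw [h1, hfar i j hij] at h2
    have h3 : 1 ≤ cf x p q i := cf_same_pos hsm (by omega)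
    have h4 : 1 ≤ cf x p q j := cf_same_pos hsm (by omega)
    nlinarith
  · intro i p1 q1 p2 q2 p3 q3 hi hi' a1 a2 a3 b1 b2 b3 c1 c2 c3
    by_contra hne
    have h1 := Mm_eq h hs heq (by omega) (by omega) hi' hi'
    rw [Bm, if_pos rfl, if_neg (by omega)] at h1
    have h4 := Mm_ge_card h x i {(p1, q1), (p2, q2), (p3, q3)} (by
        intro e he
        simp only [Finset.mem_insert, Finset.mem_singleton] at he
        rcases he with rfl | rfl | rfl
        · exact ⟨a1, a2, a3⟩
        · exact ⟨b1, b2, b3⟩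
        · exact ⟨c1, c2, c3⟩)
    rw [h1, Finset.card_eq_three.2 ⟨(p1, q1), (p2, q2), (p3, q3), by simp only [ne_eq, Prod.mk.injEq]; tauto,
      by simp only [ne_eq, Prod.mk.injEq]; tauto, by simp only [ne_eq, Prod.mk.injEq]; tauto, rfl⟩] at h4
    norm_num at h4


/-- straight crossing at levels `{t, t+1}`, `{t+2, t+3}` -/
def Strt (A : ℕ → ℕ → Prop) (t : ℕ) : Prop :=
  A t (t + 2) ∧ A (t + 1) (t + 3) ∧ ¬ A t (t + 3) ∧ ¬ A (t + 1) (t + 2)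

def Crsd (A : ℕ → ℕ → Prop) (t : ℕ) : Prop :=
  A t (t + 3) ∧ A (t + 1) (t + 2) ∧ ¬ A t (t + 2) ∧ ¬ A (t + 1) (t + 3)

lemma cross {n : ℕ} {A : ℕ → ℕ → Prop} (h : Gd n A) {x a : ℕ → ℝ} (hf : Fct n A x a) {r t : ℕ}
    (hr : ∀ g, g < n → g % 2 = r → a (g + 1) < a g) (ht : t + 3 < n) (htr : (t + 1) % 2 = r) :
    Strt A t ∨ Crsd A t := by
  have hg := hr (t + 1) (by omega) htr
  have hlow : ∀ p q, p ≤ t + 1 → t + 1 < q → A p q → p = t ∨ p = t + 1 := by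
    intro p q hp hq hA
    by_contra hne
    have := hf.jump (t - 1) (t + 1) p q (by omega) (by omega) (hr _ (by omega) (by omega)) hg
      (by omega) (by omega) hA
    omega
  have hhigh : ∀ p q, p ≤ t + 1 → t + 1 < q → A p q → q = t + 2 ∨ q = t + 3 := by
    intro p q hp hq hA
    have := hf.jump (t + 1) (t + 3) p q (by omega) (by omega) hg (hr _ (by omega) (by omega))
      (by omega) (by omega) hA
    omega
  obtain ⟨p1, q1, a1, a2, a3, a4, a5, a6⟩ := h.cut (t + 1) (t + 1) t (t + 2) (by omega) (by omega)
    (by omega) (by omega) (by omega)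
  obtain ⟨p2, q2, b1, b2, b3, b4, b5, b6⟩ := h.cut t (t + 1) (t + 1) (t + 2) (by omega) (by omega)
    (by omega) (by omega) (by omega)
  obtain ⟨p3, q3, c1, c2, c3, c4, c5, c6⟩ := h.cut (t + 2) (t + 1) t (t + 3) (by omega) (by omega)
    (by omega) (by omega) (by omega)
  obtain ⟨p4, q4, d1, d2, d3, d4, d5, d6⟩ := h.cut (t + 3) (t + 1) t (t + 2) (by omega) (by omega)
    (by omega) (by omega) (by omega)
  have e1 := hlow _ _ a1 a2 a5
  have e2 := hlow _ _ b1 b2 b5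
  have f1 := hhigh _ _ a1 a2 a5
  have f2 := hhigh _ _ b1 b2 b5
  have f3 := hhigh _ _ c1 c2 c5
  have f4 := hhigh _ _ d1 d2 d5
  have T := fun p1 q1 p2 q2 p3 q3 => hf.three (t + 1) p1 q1 p2 q2 p3 q3 (by omega) hg
  have k1 : p1 = t := by omega
  have k2 : p2 = t + 1 := by omega
  have k3 : q3 = t + 3 := by omega
  have k4 : q4 = t + 2 := by omega
  subst k1 k2 k3 k4
  rcases f1 with rfl | rfl <;> rcases f2 with rfl | rfl
  · have := T _ _ _ _ _ _ a1 a2 a5 b1 b2 b5 c1 c2 c5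
    omega
  · left
    refine ⟨a5, b5, fun hh => ?_, fun hh => ?_⟩
    · have := T _ _ _ _ _ _ a1 a2 a5 b1 b2 b5 (by omega) (by omega) hh
      omega
    · have := T _ _ _ _ _ _ a1 a2 a5 b1 b2 b5 (by omega) (by omega) hh
      omega
  · right
    refine ⟨a5, b5, fun hh => ?_, fun hh => ?_⟩
    · have := T _ _ _ _ _ _ a1 a2 a5 b1 b2 b5 (by omega) (by omega) hh
      omega
    · have := T _ _ _ _ _ _ a1 a2 a5 b1 b2 b5 (by omega) (by omega) hh
      omega
  · have := T _ _ _ _ _ _ a1 a2 a5 b1 b2 b5 d1 d2 d5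
    omega

lemma straighten {n : ℕ} {a : ℕ → ℝ} (P : (ℕ → ℕ → Prop) → Prop) {r : ℕ}
    (hP : ∀ A, P A → Gd n A ∧ ∃ x, Fct n A x a)
    (hsw : ∀ A, P A → ∀ g, g + 1 < n → a g = a (g + 1) →
      P (fun i j => A (Equiv.swap g (g + 1) i) (Equiv.swap g (g + 1) j)))
    (hanti : Antitone a)
    (hz : ∀ i, i + 2 < n → (a i = a (i + 1) ↔ a (i + 2) = a (i + 3)))
    (hr : ∀ g, g < n → g % 2 = r → a (g + 1) < a g) (A₀ : ℕ → ℕ → Prop) (hA₀ : P A₀) (N : ℕ) :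
    ∃ A, P A ∧ ∀ t, t < N → t + 3 < n → (t + 1) % 2 = r → Strt A t := by
  induction N with
  | zero => exact ⟨A₀, hA₀, by intro t ht; omega⟩
  | succ N ih =>
    obtain ⟨A, hA, hst⟩ := ih
    by_cases hN : N + 3 < n ∧ (N + 1) % 2 = r
    · obtain ⟨hN1, hN2⟩ := hN
      obtain ⟨hg, x, hf⟩ := hP A hA
      rcases cross hg hf hr hN1 hN2 with h1 | h1
      · refine ⟨A, hA, fun t ht h3 h4 => ?_⟩
        rcases Nat.lt_succ_iff_lt_or_eq.1 ht with h5 | rfl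
        · exact hst t h5 h3 h4
        · exact h1
      · by_cases he : a (N + 2) = a (N + 3)
        · refine ⟨_, hsw A hA (N + 2) (by omega) he, fun t ht h3 h4 => ?_⟩
          have hsame : ∀ i, i < N + 2 → Equiv.swap (N + 2) (N + 2 + 1) i = i := fun i hi =>
            Equiv.swap_apply_of_ne_of_ne (by omega) (by omega)
          unfold Strt
          beta_reduce
          rcases Nat.lt_succ_iff_lt_or_eq.1 ht with h5 | rfl
          · have := hst t h5 h3 h4
            rw [hsame _ (by omega), hsame _ (by omega), hsame _ (by omega), hsame _ (by omega)]
            exact this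
          · rw [show t + 3 = t + 2 + 1 by ring, Equiv.swap_apply_left, Equiv.swap_apply_right]
            rw [hsame _ (by omega), hsame _ (by omega)]
            exact h1
        · exfalso
          have h6 : a N ≠ a (N + 1) := fun hh => he ((hz N (by omega)).1 hh)
          have h7 := hf.jump N (N + 2) N (N + 3) le_rfl (by omega)
            (lt_of_le_of_ne (hanti (by omega)) (Ne.symm h6))
            (lt_of_le_of_ne (hanti (by omega)) (Ne.symm he)) le_rfl (by omega) h1.1
          omega
    · refine ⟨A, hA, fun t ht h3 h4 => ?_⟩
      rcases Nat.lt_succ_iff_lt_or_eq.1 ht with h5 | rfl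
      · exact hst t h5 h3 h4
      · exact absurd ⟨h3, h4⟩ hN

/-- Final shape of the adjacency relation. -/
def Shape (n : ℕ) (S : Finset ℕ) (A : ℕ → ℕ → Prop) : Prop :=
  ∀ p q, p < q → q < n → (A p q ↔ q = p + 2 ∨ (p = 0 ∧ q = 1) ∨ (p + 2 = n ∧ q + 1 = n) ∨
    (q = p + 1 ∧ ∃ i ∈ S, p + 2 * i + 1 = n))

lemma shape_even {n : ℕ} (hodd : n % 2 = 1) {A : ℕ → ℕ → Prop} (h : Gd n A) {x a : ℕ → ℝ}
    (hf : Fct n A x a)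
    (hr : ∀ g, g < n → g % 2 = 0 → a (g + 1) < a g)
    (hst : ∀ t, t + 3 < n → (t + 1) % 2 = 0 → Strt A t) : Shape n ∅ A := by
  have hn := h.hn
  have h01 : A 0 1 := by
    obtain ⟨p1, q1, a1, a2, a3, a4, a5, a6⟩ := h.cut 2 0 0 1 (by omega) (by omega)
      (by omega) (by omega) (by omega)
    have := hf.jump 0 2 p1 q1 (by omega) (by omega) (hr _ (by omega) (by omega))
      (hr _ (by omega) (by omega)) (by omega) (by omega) a5
    obtain rfl : p1 = 0 := by omega
    obtain rfl : q1 = 1 := by omega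
    exact a5
  have h02 : A 0 2 := by
    obtain ⟨p1, q1, a1, a2, a3, a4, a5, a6⟩ := h.cut 1 0 0 2 (by omega) (by omega)
      (by omega) (by omega) (by omega)
    have := hf.jump 0 2 p1 q1 (by omega) (by omega) (hr _ (by omega) (by omega))
      (hr _ (by omega) (by omega)) (by omega) (by omega) a5
    obtain rfl : p1 = 0 := by omega
    obtain rfl : q1 = 2 := by omega
    exact a5
  have hsame : ∀ p q, p < q → q < n → A p q → (0 ≤ x p ↔ 0 ≤ x q) → p + 2 = n ∧ q + 1 = n := by
    intro p q hpq hq hA hs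
    have := hf.same (n - 3) (n - 1) p q (by omega) (by omega) (hr _ (by omega) (by omega))
      (hr _ (by omega) (by omega)) hpq hA hs
    omega
  have hstep : ∀ p, p + 2 < n → A p (p + 2) := by
    intro p hp
    rcases Nat.eq_zero_or_pos p with rfl | hp0
    · exact h02
    rcases Nat.mod_two_eq_zero_or_one p with h1 | h1
    · obtain ⟨k, rfl⟩ : ∃ k, p = k + 1 := ⟨p - 1, by omega⟩
      exact (hst k (by omega) (by omega)).2.1
    · exact (hst p (by omega) (by omega)).1
  have hlast : A (n - 2) (n - 1) := by
    obtain ⟨p, q, hpq, hq, hA, hs⟩ := h.same x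
    have := hsame p q hpq hq hA hs
    obtain rfl : p = n - 2 := by omega
    obtain rfl : q = n - 1 := by omega
    exact hA
  have hcol : ∀ k, 2 * k + 2 < n → (0 ≤ x (2 * k + 1) ↔ 0 ≤ x (2 * k + 2)) := by
    intro k
    induction k with
    | zero =>
      intro hk
      have h1 : ¬ (0 ≤ x 0 ↔ 0 ≤ x 1) := fun hs => by
        have := hsame 0 1 (by omega) (by omega) h01 hs
        omega
      have h2 : ¬ (0 ≤ x 0 ↔ 0 ≤ x 2) := fun hs => by
        have := hsame 0 2 (by omega) (by omega) h02 hs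
        omega
      simp only [Nat.mul_zero, Nat.zero_add]
      tauto
    | succ k ih =>
      intro hk
      have h0 := ih (by omega)
      have h1 : ¬ (0 ≤ x (2 * k + 1) ↔ 0 ≤ x (2 * k + 3)) := fun hs => by
        have := hsame _ _ (by omega) (by omega) (hstep (2 * k + 1) (by omega)) hs
        omega
      have h2 : ¬ (0 ≤ x (2 * k + 2) ↔ 0 ≤ x (2 * k + 4)) := fun hs => by
        have := hsame _ _ (by omega) (by omega) (hstep (2 * k + 2) (by omega)) hs
        omega
      rw [show 2 * (k + 1) + 1 = 2 * k + 3 by ring, show 2 * (k + 1) + 2 = 2 * k + 4 by ring]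
      tauto
  intro p q hpq hq
  simp only [Finset.notMem_empty, false_and, exists_false, and_false, or_false]
  constructor
  · intro hA
    have hle : q ≤ p + 3 := by
      by_contra hcon
      have := hf.jump (p + p % 2) (p + p % 2 + 2) (p) q (by omega) (by omega)
        (hr _ (by omega) (by omega)) (hr _ (by omega) (by omega)) (by omega) (by omega) hA
      omega
    rcases (by omega : q = p + 1 ∨ q = p + 2 ∨ q = p + 3) with rfl | rfl | rfl
    · rcases Nat.mod_two_eq_zero_or_one p with h1 | h1
      · rcases Nat.eq_zero_or_pos p with rfl | hp0
        · simp
        · obtain ⟨k, rfl⟩ : ∃ k, p = k + 1 := ⟨p - 1, by omega⟩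
          exact absurd hA (hst k (by omega) (by omega)).2.2.2
      · obtain ⟨k, rfl⟩ : ∃ k, p = 2 * k + 1 := ⟨p / 2, by omega⟩
        have := hsame _ _ hpq hq hA (hcol k (by omega))
        exact Or.inr (Or.inr this)
    · exact Or.inl rfl
    · exfalso
      rcases Nat.mod_two_eq_zero_or_one p with h1 | h1
      · have := hf.jump p (p + 2) (p) (p + 3) (by omega) (by omega)
          (hr _ (by omega) (by omega)) (hr _ (by omega) (by omega)) (by omega) (by omega) hA
        omega
      · exact absurd hA (hst p (by omega) (by omega)).2.2.1
  · rintro (rfl | ⟨rfl, rfl⟩ | ⟨h1, h2⟩)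
    · exact hstep p hq
    · exact h01
    · obtain rfl : p = n - 2 := by omega
      obtain rfl : q = n - 1 := by omega
      exact hlast

lemma shape_odd {n : ℕ} (hodd : n % 2 = 1) {A : ℕ → ℕ → Prop} (h : Gd n A) {x a : ℕ → ℝ}
    (hf : Fct n A x a)
    (hr : ∀ g, g < n → g % 2 = 1 → a (g + 1) < a g)
    (hst : ∀ t, t + 3 < n → (t + 1) % 2 = 1 → Strt A t) : 
    ∃ S : Finset ℕ, (∀ i ∈ S, 1 ≤ i ∧ i ≤ (n - 3) / 2) ∧ Shape n S A := by
  have hn := h.hn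
  refine ⟨(Finset.Icc 1 ((n - 3) / 2)).filter (fun i => A (n - 1 - 2 * i) (n - 2 * i)), ?_, ?_⟩
  · intro i hi
    simpa using (Finset.mem_filter.1 hi).1
  have h01 : A 0 1 := by
    obtain ⟨p1, q1, a1, a2, a3, a4, a5, a6⟩ := h.cut 2 0 0 1 (by omega) (by omega)
      (by omega) (by omega) (by omega)
    obtain rfl : p1 = 0 := by omega
    by_cases h3 : n = 3
    · obtain rfl : q1 = 1 := by omega
      exact a5
    · have := hf.jump 1 3 0 q1 (by omega) (by omega) (hr _ (by omega) (by omega))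
        (hr _ (by omega) (by omega)) (by omega) (by omega) a5
      rcases (by omega : q1 = 1 ∨ q1 = 3) with rfl | rfl
      · exact a5
      · exact absurd a5 (hst 0 (by omega) (by omega)).2.2.1
  have hb : ∀ p q, p ≤ n - 2 → n - 2 < q → A p q → n ≤ p + 3 := by
    intro p q hp hq hA
    by_contra hcon
    have := hf.jump (n - 4) (n - 2) p q (by omega) (by omega) (hr _ (by omega) (by omega))
        (hr _ (by omega) (by omega)) (by omega) (by omega) hA
    omega
  have hb1 : A (n - 3) (n - 1) := by
    obtain ⟨p1, q1, a1, a2, a3, a4, a5, a6⟩ := h.cut (n - 2) (n - 2) (n - 3) (n - 1) (by omega)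
      (by omega) (by omega) (by omega) (by omega)
    have := hb _ _ a1 a2 a5
    obtain rfl : p1 = n - 3 := by omega
    obtain rfl : q1 = n - 1 := by omega
    exact a5
  have hb2 : A (n - 2) (n - 1) := by
    obtain ⟨p1, q1, a1, a2, a3, a4, a5, a6⟩ := h.cut (n - 3) (n - 2) (n - 2) (n - 1) (by omega)
      (by omega) (by omega) (by omega) (by omega)
    have := hb _ _ a1 a2 a5
    obtain rfl : p1 = n - 2 := by omega
    obtain rfl : q1 = n - 1 := by omega
    exact a5
  have hstep : ∀ p, p + 2 < n → A p (p + 2) := by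
    intro p hp
    rcases Nat.mod_two_eq_zero_or_one p with h1 | h1
    · by_cases h2 : p + 3 = n
      · obtain rfl : p = n - 3 := by omega
        rw [show n - 3 + 2 = n - 1 by omega]
        exact hb1
      · exact (hst p (by omega) (by omega)).1
    · obtain ⟨k, rfl⟩ : ∃ k, p = k + 1 := ⟨p - 1, by omega⟩
      exact (hst k (by omega) (by omega)).2.1
  intro p q hpq hq
  constructor
  · intro hA
    have hle : q ≤ p + 3 := by
      by_contra hcon
      have := hf.jump (p + (p + 1) % 2) (p + (p + 1) % 2 + 2) (p) q (by omega) (by omega)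
        (hr _ (by omega) (by omega)) (hr _ (by omega) (by omega)) (by omega) (by omega) hA
      omega
    rcases (by omega : q = p + 1 ∨ q = p + 2 ∨ q = p + 3) with rfl | rfl | rfl
    · rcases Nat.mod_two_eq_zero_or_one p with h1 | h1
      · rcases Nat.eq_zero_or_pos p with rfl | hp0
        · simp
        · refine Or.inr (Or.inr (Or.inr ⟨rfl, (n - 1 - p) / 2, ?_, by omega⟩))
          rw [Finset.mem_filter, Finset.mem_Icc]
          refine ⟨⟨by omega, by omega⟩, ?_⟩
          rw [show n - 1 - 2 * ((n - 1 - p) / 2) = p by omega, 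
            show n - 2 * ((n - 1 - p) / 2) = p + 1 by omega]
          exact hA
      · by_cases h2 : p + 2 = n
        · exact Or.inr (Or.inr (Or.inl ⟨h2, by omega⟩))
        · obtain ⟨k, rfl⟩ : ∃ k, p = k + 1 := ⟨p - 1, by omega⟩
          exact absurd hA (hst k (by omega) (by omega)).2.2.2
    · exact Or.inl rfl
    · exfalso
      rcases Nat.mod_two_eq_zero_or_one p with h1 | h1
      · exact absurd hA (hst p (by omega) (by omega)).2.2.1
      · have := hf.jump p (p + 2) (p) (p + 3) (by omega) (by omega)
          (hr _ (by omega) (by omega)) (hr _ (by omega) (by omega)) (by omega) (by omega) hA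
        omega
  · rintro (rfl | ⟨rfl, rfl⟩ | ⟨h1, h2⟩ | ⟨rfl, i, hi, hh⟩)
    · exact hstep p hq
    · exact h01
    · obtain rfl : p = n - 2 := by omega
      obtain rfl : q = n - 1 := by omega
      exact hb2
    · have := (Finset.mem_filter.1 hi).2
      rwa [show n - 1 - 2 * i = p by omega, show n - 2 * i = p + 1 by omega] at this

/-- Combinatorial conclusion. -/
lemma comb {n : ℕ} (hodd : n % 2 = 1) {a : ℕ → ℝ} (P : (ℕ → ℕ → Prop) → Prop)
    (hP : ∀ A, P A → Gd n A ∧ ∃ x, Fct n A x a)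
    (hsw : ∀ A, P A → ∀ g, g + 1 < n → a g = a (g + 1) →
      P (fun i j => A (Equiv.swap g (g + 1) i) (Equiv.swap g (g + 1) j)))
    (hanti : Antitone a) (h0 : ∀ i, n ≤ i → a i = 0) (hne : a 0 ≠ 0)
    (hz : ∀ i, i + 2 < n → (a i = a (i + 1) ↔ a (i + 2) = a (i + 3)))
    (A₀ : ℕ → ℕ → Prop) (hA₀ : P A₀) :
    ∃ A, P A ∧ ∃ S : Finset ℕ, (∀ i ∈ S, 1 ≤ i ∧ i ≤ (n - 3) / 2) ∧ Shape n S A := by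
  have hpar : ∀ k r, 2 * k + r < n → (a (2 * k + r) = a (2 * k + r + 1) ↔ a r = a (r + 1)) := by
    intro k r
    induction k with
    | zero => simp
    | succ k ih =>
      intro hk
      rw [← ih (by omega), hz (2 * k + r) (by omega),
        show 2 * (k + 1) + r = 2 * k + r + 2 by ring]
  have hpos : ∀ r, r < 2 → a r ≠ a (r + 1) → ∀ g, g < n → g % 2 = r → a (g + 1) < a g := by
    intro r hr hr' g hg hgr
    refine lt_of_le_of_ne (hanti (by omega)) fun hh => hr' ?_
    rw [← hpar (g / 2) r (by omega), show 2 * (g / 2) + r = g by omega]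
    exact hh.symm
  by_cases h1 : a 0 = a 1
  · have h2 : a 1 ≠ a 2 := by
      intro h2
      apply hne
      have : ∀ i, i ≤ n → a 0 = a i := by
        intro i
        induction i with
        | zero => simp
        | succ i ih =>
          intro hi
          rw [ih (by omega)]
          rcases Nat.mod_two_eq_zero_or_one i with h3 | h3
          · have := hpar (i / 2) 0 (by omega)
            rw [show 2 * (i / 2) + 0 = i by omega] at this
            exact this.2 h1
          · have := hpar (i / 2) 1 (by omega)
            rw [show 2 * (i / 2) + 1 = i by omega] at this
            exact this.2 h2
      rw [this n le_rfl, h0 n le_rfl]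
    have hr := hpos 1 (by omega) h2
    obtain ⟨A, hA, hst⟩ := straighten P hP hsw hanti hz hr A₀ hA₀ n
    obtain ⟨hg, x, hf⟩ := hP A hA
    exact ⟨A, hA, shape_odd hodd hg hf hr fun t ht => hst t (by omega) ht⟩
  · have hr := hpos 0 (by omega) h1
    obtain ⟨A, hA, hst⟩ := straighten P hP hsw hanti hz hr A₀ hA₀ n
    obtain ⟨hg, x, hf⟩ := hP A hA
    exact ⟨A, hA, ∅, by simp, shape_even hodd hg hf hr fun t ht => hst t (by omega) ht⟩

end Core


section Spec

lemma sl_mulVec {V : Type*} [Fintype V] (G : SimpleGraph V) (x : V → ℝ) (u : V) :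
    (signlessLaplacian G).mulVec x u = ∑ v, if G.Adj u v then x u + x v else 0 := by
  have hdeg : ((G.neighborSet u).ncard : ℝ) = ∑ v, if G.Adj u v then (1 : ℝ) else 0 := by
    rw [Set.ncard_eq_toFinset_card', Finset.sum_boole]
    congr 2
    ext v; simp
  simp only [Matrix.mulVec, dotProduct, signlessLaplacian, add_mul, Finset.sum_add_distrib]
  simp only [ite_mul, zero_mul, Finset.sum_ite_eq, Finset.mem_univ, if_true, one_mul]
  rw [hdeg, Finset.sum_mul, ← Finset.sum_add_distrib]
  refine Finset.sum_congr rfl fun v _ => ?_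
  split_ifs <;> simp

lemma sl_quad {V : Type*} [Fintype V] (G : SimpleGraph V) (x : V → ℝ) :
    2 * (x ⬝ᵥ (signlessLaplacian G).mulVec x) = ∑ u, ∑ v, if G.Adj u v then (x u + x v) ^ 2 else 0 := by
  have h1 : x ⬝ᵥ (signlessLaplacian G).mulVec x =
      ∑ u, ∑ v, if G.Adj u v then x u * (x u + x v) else 0 := by
    simp only [dotProduct, sl_mulVec, Finset.mul_sum, mul_ite, mul_zero]
  have h2 : x ⬝ᵥ (signlessLaplacian G).mulVec x =
      ∑ u, ∑ v, if G.Adj u v then x v * (x u + x v) else 0 := by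
    rw [h1, Finset.sum_comm]
    refine Finset.sum_congr rfl fun v _ => Finset.sum_congr rfl fun u _ => ?_
    simp only [G.adj_comm u v]
    split_ifs <;> ring
  rw [two_mul]
  nth_rewrite 1 [h1]
  rw [h2, ← Finset.sum_add_distrib]
  refine Finset.sum_congr rfl fun v _ => ?_
  rw [← Finset.sum_add_distrib]
  refine Finset.sum_congr rfl fun u _ => ?_
  split_ifs <;> ring

lemma sl_herm {V : Type*} [Fintype V] (G : SimpleGraph V) : (signlessLaplacian G).IsHermitian := by
  ext i j
  simp only [Matrix.conjTranspose_apply, signlessLaplacian, star_trivial, G.adj_comm j i]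
  by_cases h : i = j
  · subst h; rfl
  · simp [h, Ne.symm h]

lemma eig_bdd {V : Type*} [Fintype V] (G : SimpleGraph V) :
    BddBelow {μ : ℝ | ∃ x : V → ℝ, x ≠ 0 ∧ (signlessLaplacian G).mulVec x = μ • x} := by
  refine ⟨0, ?_⟩
  rintro μ ⟨x, hx, he⟩
  have h1 := sl_quad G x
  have h2 : 0 ≤ ∑ u, ∑ v, if G.Adj u v then (x u + x v) ^ 2 else 0 :=
    Finset.sum_nonneg fun u _ => Finset.sum_nonneg fun v _ => by positivity
  rw [he, dotProduct_smul, smul_eq_mul] at h1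
  have h3 : 0 < x ⬝ᵥ x := by
    have := dotProduct_star_self_pos_iff (v := x)
    simpa using this.2 hx
  by_contra hneg
  have := mul_neg_of_neg_of_pos (not_le.1 hneg) h3
  linarith

lemma eig_exists {V : Type*} [Fintype V] [Nonempty V] (G : SimpleGraph V) :
    ∃ x : V → ℝ, x ≠ 0 ∧ (signlessLaplacian G).mulVec x = leastQEig G • x := by
  have hfin : {μ : ℝ | ∃ x : V → ℝ, x ≠ 0 ∧ (signlessLaplacian G).mulVec x = μ • x}.Finite := by
    refine (Module.End.finite_hasEigenvalue (Matrix.toLin' (signlessLaplacian G))).subset ?_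
    rintro μ ⟨x, hx, he⟩
    refine Module.End.hasEigenvalue_of_hasEigenvector (x := x) ⟨?_, hx⟩
    rw [Module.End.mem_eigenspace_iff, Matrix.toLin'_apply]
    exact he
  have hne : {μ : ℝ | ∃ x : V → ℝ, x ≠ 0 ∧ (signlessLaplacian G).mulVec x = μ • x}.Nonempty := by
    obtain ⟨v⟩ := ‹Nonempty V›
    refine ⟨(sl_herm G).eigenvalues v, ((sl_herm G).eigenvectorBasis v).ofLp, ?_, ?_⟩
    · intro h
      have := (sl_herm G).eigenvectorBasis.orthonormal.ne_zero v
      apply this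
      ext i
      exact congrFun h i
    · exact (sl_herm G).mulVec_eigenvectorBasis v
  exact hne.csInf_mem hfin

lemma sl_psd {V : Type*} [Fintype V] (G : SimpleGraph V) :
    (signlessLaplacian G - leastQEig G • (1 : Matrix V V ℝ)).PosSemidef := by
  have hH : (signlessLaplacian G - leastQEig G • (1 : Matrix V V ℝ)).IsHermitian := by
    refine (sl_herm G).sub ?_
    ext i j
    simp [Matrix.one_apply, eq_comm]
  rw [hH.posSemidef_iff_eigenvalues_nonneg]
  intro v
  have h1 := hH.mulVec_eigenvectorBasis v
  rw [Matrix.sub_mulVec, Matrix.smul_mulVec, Matrix.one_mulVec] at h1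
  have h2 : leastQEig G ≤ hH.eigenvalues v + leastQEig G := by
    refine csInf_le (eig_bdd G) ⟨(hH.eigenvectorBasis v).ofLp, ?_, ?_⟩
    · intro h
      have := hH.eigenvectorBasis.orthonormal.ne_zero v
      apply this
      ext i
      exact congrFun h i
    · rw [add_smul, ← h1]; simp
  simp only [Pi.zero_apply]
  linarith

lemma rayleigh_le {V : Type*} [Fintype V] (G : SimpleGraph V) (x : V → ℝ) :
    leastQEig G * (x ⬝ᵥ x) ≤ x ⬝ᵥ (signlessLaplacian G).mulVec x := by
  have := (sl_psd G).dotProduct_mulVec_nonneg x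
  rw [Matrix.sub_mulVec, Matrix.smul_mulVec, Matrix.one_mulVec, star_trivial, dotProduct_sub,
    dotProduct_smul, smul_eq_mul] at this
  linarith

lemma rayleigh_eq {V : Type*} [Fintype V] (G : SimpleGraph V) (x : V → ℝ)
    (h : x ⬝ᵥ (signlessLaplacian G).mulVec x = leastQEig G * (x ⬝ᵥ x)) :
    (signlessLaplacian G).mulVec x = leastQEig G • x := by
  have := (sl_psd G).dotProduct_mulVec_zero_iff x
  rw [Matrix.sub_mulVec, Matrix.smul_mulVec, Matrix.one_mulVec, star_trivial, dotProduct_sub,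
    dotProduct_smul, smul_eq_mul, h, sub_self] at this
  exact sub_eq_zero.1 (this.1 rfl)

lemma least_iso_aux {V W : Type*} [Fintype V] [Fintype W] (G : SimpleGraph V) (H : SimpleGraph W)
    (f : G ≃g H) (μ : ℝ) (h : ∃ x : V → ℝ, x ≠ 0 ∧ (signlessLaplacian G).mulVec x = μ • x) :
    ∃ x : W → ℝ, x ≠ 0 ∧ (signlessLaplacian H).mulVec x = μ • x := by
  obtain ⟨x, hx, he⟩ := h
  refine ⟨fun w => x (f.symm w), ?_, ?_⟩
  · intro h0
    apply hx
    funext v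
    have := congrFun h0 (f v)
    simpa using this
  · funext w
    have h1 := congrFun he (f.symm w)
    rw [sl_mulVec] at h1 ⊢
    simp only [Pi.smul_apply, smul_eq_mul] at h1 ⊢
    rw [← h1]
    refine (Fintype.sum_equiv f.toEquiv _ _ fun v => ?_).symm
    have h2 : G.Adj (f.symm w) v ↔ H.Adj w (f v) := by
      rw [← f.map_adj_iff]; simp
    simp [h2]

lemma least_iso {V W : Type*} [Fintype V] [Fintype W] (G : SimpleGraph V) (H : SimpleGraph W)
    (f : G ≃g H) : leastQEig G = leastQEig H := by
  unfold leastQEig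
  congr 1
  ext μ
  exact ⟨least_iso_aux G H f μ, least_iso_aux H G f.symm μ⟩

end Spec


section Trans

/-- adjacency in terms of natural number labels -/
def An {V : Type*} {n : ℕ} (G : SimpleGraph V) (w : Fin n ≃ V) (i j : ℕ) : Prop :=
  ∃ (hi : i < n) (hj : j < n), G.Adj (w ⟨i, hi⟩) (w ⟨j, hj⟩)

/-- vector in terms of natural number labels -/
noncomputable def xn {V : Type*} {n : ℕ} (x : V → ℝ) (w : Fin n ≃ V) (i : ℕ) : ℝ :=
  if h : i < n then x (w ⟨i, h⟩) else 0

lemma xn_val {V : Type*} {n : ℕ} (x : V → ℝ) (w : Fin n ≃ V) (i : Fin n) :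
    xn x w i = x (w i) := by simp [xn]

lemma An_val {V : Type*} {n : ℕ} (G : SimpleGraph V) (w : Fin n ≃ V) (i j : Fin n) :
    An G w i j ↔ G.Adj (w i) (w j) := by simp [An]

lemma cutV {V : Type*} [Fintype V] (G : SimpleGraph V) (h2 : TwoConnected G) (v : V) (U : Set V)
    (u u' : V) (hu : u ∈ U) (hu' : u' ∉ U) (huv : u ≠ v) (huv' : u' ≠ v) :
    ∃ p q, p ∈ U ∧ q ∉ U ∧ p ≠ v ∧ q ≠ v ∧ G.Adj p q := by
  have hc := h2.2 v
  have m1 : u ∈ ((⊤ : G.Subgraph).deleteVerts {v}).verts := by simp [huv]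
  have m2 : u' ∈ ((⊤ : G.Subgraph).deleteVerts {v}).verts := by simp [huv']
  obtain ⟨p⟩ := hc.preconnected ⟨u, m1⟩ ⟨u', m2⟩
  obtain ⟨d, -, h3, h4⟩ := p.exists_boundary_dart {y | (y : V) ∈ U} hu hu'
  have hadj := d.adj
  rw [Subgraph.coe_adj, Subgraph.deleteVerts_adj] at hadj
  refine ⟨_, _, h3, h4, ?_, ?_, ?_⟩
  · simpa using hadj.2.1
  · simpa using hadj.2.2.2.1
  · simpa using hadj.2.2.2.2

lemma gd_of {V : Type*} [Fintype V] {n : ℕ} (hn : 3 ≤ n) (G : SimpleGraph V) (w : Fin n ≃ V)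
    (h2 : TwoConnected G) (hnb : ¬ G.Colorable 2) : Gd n (An G w) := by
  have hK : ∀ (v : ℕ) (U : ℕ → Prop), v < n → (∃ u, U u ∧ u < n ∧ u ≠ v) →
      (∃ u, ¬ U u ∧ u < n ∧ u ≠ v) → ∃ p q, U p ∧ ¬ U q ∧ p ≠ v ∧ q ≠ v ∧ An G w p q := by
    rintro v U hv ⟨u, hu, hun, huv⟩ ⟨u', hu', hun', huv'⟩
    obtain ⟨p, q, hp, hq, hpv, hqv, hA⟩ := cutV G h2 (w ⟨v, hv⟩) {y | U (w.symm y)} (w ⟨u, hun⟩)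
      (w ⟨u', hun'⟩) (by simpa using hu) (by simpa using hu') (by simpa using huv)
      (by simpa using huv')
    refine ⟨w.symm p, w.symm q, hp, hq, ?_, ?_, ?_⟩
    · intro hh
      apply hpv
      have : w.symm p = ⟨v, hv⟩ := Fin.ext hh
      rw [← this]; simp
    · intro hh
      apply hqv
      have : w.symm q = ⟨v, hv⟩ := Fin.ext hh
      rw [← this]; simp
    · rw [An_val]; simpa using hA
  refine ⟨hn, ?_, ?_, ?_, ?_, ?_⟩
  · rintro p q ⟨hp, hq, hA⟩
    exact ⟨hq, hp, hA.symm⟩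
  · rintro p ⟨hp, _, hA⟩
    exact G.loopless.irrefl _ hA
  · rintro p q ⟨hp, _⟩
    exact hp
  · intro v U h1 h3
    by_cases hv : v < n
    · exact hK v U hv h1 h3
    · obtain ⟨u, hu, hun, huv⟩ := h1
      obtain ⟨u', hu', hun', huv'⟩ := h3
      obtain ⟨v', hv', hvu, hvu'⟩ : ∃ v', v' < n ∧ u ≠ v' ∧ u' ≠ v' := by
        by_cases h0 : u ≠ 0 ∧ u' ≠ 0
        · exact ⟨0, by omega, h0.1, h0.2⟩
        · by_cases h1 : u ≠ 1 ∧ u' ≠ 1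
          · exact ⟨1, by omega, h1.1, h1.2⟩
          · exact ⟨2, by omega, by omega, by omega⟩
      obtain ⟨p, q, hp, hq, _, _, hA⟩ := hK v' U hv' ⟨u, hu, hun, hvu⟩ ⟨u', hu', hun', hvu'⟩
      have hpn : p < n := hA.1
      have hqn : q < n := hA.2.1
      exact ⟨p, q, hp, hq, by omega, by omega, hA⟩
  · intro c
    by_contra hcon
    push Not at hcon
    apply hnb
    have C : G.Coloring Bool := Coloring.mk (fun v => decide (c (w.symm v))) (by
      intro a b hab heq
      have h1 := hcon (w.symm a) (w.symm b) (by rw [An_val]; simpa using hab)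
      have h2 : c (w.symm a) ↔ c (w.symm b) := by simpa using heq
      tauto)
    simpa using C.colorable

lemma quad_En {V : Type*} [Fintype V] {n : ℕ} (G : SimpleGraph V) (w : Fin n ≃ V) (x : V → ℝ) :
    x ⬝ᵥ (signlessLaplacian G).mulVec x = En n (An G w) (xn x w) := by
  have h1 := sl_quad G x
  have h2 : (∑ u, ∑ v, if G.Adj u v then (x u + x v) ^ 2 else 0) =
      ∑ i ∈ Finset.range n, ∑ j ∈ Finset.range n,
        if An G w i j then (xn x w i + xn x w j) ^ 2 else 0 := by
    rw [Finset.sum_range]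
    refine (Fintype.sum_equiv w _ _ fun i => ?_).symm
    rw [Finset.sum_range]
    refine (Fintype.sum_equiv w _ _ fun j => ?_)
    simp only [xn_val, An_val]
  have h3 : En n (An G w) (xn x w) = ∑ i ∈ Finset.range n, ∑ j ∈ Finset.range n,
        if i < j ∧ An G w i j then (xn x w i + xn x w j) ^ 2 else 0 := by
    rw [En, PE, Finset.sum_filter, Finset.sum_product]
  have h4 : En n (An G w) (xn x w) = ∑ i ∈ Finset.range n, ∑ j ∈ Finset.range n,
        if j < i ∧ An G w i j then (xn x w i + xn x w j) ^ 2 else 0 := by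
    rw [h3, Finset.sum_comm]
    refine Finset.sum_congr rfl fun i _ => Finset.sum_congr rfl fun j _ => ?_
    have : An G w i j ↔ An G w j i :=
      ⟨fun ⟨a, b, c⟩ => ⟨b, a, c.symm⟩, fun ⟨a, b, c⟩ => ⟨b, a, c.symm⟩⟩
    rw [this, add_comm]
  have h5 : (∑ i ∈ Finset.range n, ∑ j ∈ Finset.range n,
        if An G w i j then (xn x w i + xn x w j) ^ 2 else 0) =
        En n (An G w) (xn x w) + En n (An G w) (xn x w) := by
    nth_rewrite 1 [h3]
    rw [h4, ← Finset.sum_add_distrib]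
    refine Finset.sum_congr rfl fun i _ => ?_
    rw [← Finset.sum_add_distrib]
    refine Finset.sum_congr rfl fun j _ => ?_
    rcases lt_trichotomy i j with h | h | h
    · simp [h, not_lt.2 h.le]
    · subst h
      have : ¬ An G w i i := fun ⟨a, b, c⟩ => G.loopless.irrefl _ c
      simp [this]
    · simp [h, not_lt.2 h.le]
  rw [h2, h5] at h1
  linarith

/-- position map -/
def sg (n p : ℕ) : ℕ := if 2 * p + 1 ≤ n then n - 1 - 2 * p else 2 * p - n

def sgi (n k : ℕ) : ℕ := if k % 2 = 0 then (n - 1 - k) / 2 else (k + n) / 2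

def sgE (n : ℕ) (hodd : n % 2 = 1) : Fin n ≃ Fin n where
  toFun p := ⟨sg n p, by have := p.2; unfold sg; split_ifs <;> omega⟩
  invFun k := ⟨sgi n k, by have := k.2; unfold sgi; split_ifs <;> omega⟩
  left_inv p := by
    have := p.2
    apply Fin.ext
    simp only [sg, sgi]
    split_ifs <;> omega
  right_inv p := by
    have := p.2
    apply Fin.ext
    simp only [sg, sgi]
    split_ifs <;> omega

lemma cyc_iff {n : ℕ} (hn : 3 ≤ n) (hodd : n % 2 = 1) (p q : ℕ) (hp : p < n) (hq : q < n) :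
    ((p + 1) % n = q ∨ (q + 1) % n = p) ↔
      (sg n p < sg n q ∧ (sg n q = sg n p + 2 ∨ (sg n p = 0 ∧ sg n q = 1) ∨
        (sg n p + 2 = n ∧ sg n q + 1 = n))) ∨
      (sg n q < sg n p ∧ (sg n p = sg n q + 2 ∨ (sg n q = 0 ∧ sg n p = 1) ∨
        (sg n q + 2 = n ∧ sg n p + 1 = n))) := by
  have h1 : ∀ p, p < n → (p + 1) % n = if p + 1 = n then 0 else p + 1 := by
    intro p hp
    split_ifs with h
    · rw [h, Nat.mod_self]
    · exact Nat.mod_eq_of_lt (by omega)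
  rw [h1 p hp, h1 q hq]
  unfold sg
  split_ifs <;> omega

lemma chord_iff {n : ℕ} (hn : 3 ≤ n) (hodd : n % 2 = 1) (p q i : ℕ) (hp : p < n) (hq : q < n)
    (hi : 1 ≤ i ∧ i ≤ (n - 3) / 2) :
    (p = i ∧ q = n - i) ↔ (sg n q = sg n p + 1 ∧ sg n p + 2 * i + 1 = n) := by
  unfold sg
  split_ifs <;> omega

lemma iso_of_shape {V : Type*} {n : ℕ} (hn : 3 ≤ n) (hodd : n % 2 = 1) (G : SimpleGraph V)
    (w : Fin n ≃ V) (S : Finset ℕ) (hS : ∀ i ∈ S, 1 ≤ i ∧ i ≤ (n - 3) / 2)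
    (hsh : Shape n S (An G w)) : Nonempty (G ≃g Hgraph n S) := by
  refine ⟨RelIso.symm ⟨(sgE n hodd).trans w, ?_⟩⟩
  intro p q
  by_cases hpq : p = q
  · subst hpq; simp
  have hpq' : p.val ≠ q.val := fun h => hpq (Fin.ext h)
  have hsne : sg n p ≠ sg n q := by
    intro h
    apply hpq
    apply (sgE n hodd).injective
    exact Fin.ext h
  have hadj : G.Adj (((sgE n hodd).trans w) p) (((sgE n hodd).trans w) q) ↔
      An G w (sg n p) (sg n q) := (An_val G w (sgE n hodd p) (sgE n hodd q)).symm
  have hsymm : An G w (sg n p) (sg n q) ↔ An G w (sg n q) (sg n p) :=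
      ⟨fun ⟨a, b, c⟩ => ⟨b, a, c.symm⟩, fun ⟨a, b, c⟩ => ⟨b, a, c.symm⟩⟩
  have hsp : sg n p < n := (sgE n hodd p).2
  have hsq : sg n q < n := (sgE n hodd q).2
  rw [hadj]
  simp only [Hgraph, cycleG, SimpleGraph.sup_adj, SimpleGraph.fromRel_adj, ne_eq, hpq,
    not_false_eq_true, true_and]
  rw [cyc_iff hn hodd p q p.2 q.2]
  have c1 : (∃ i ∈ S, p.val = i ∧ q.val = n - i) ↔
      (sg n q = sg n p + 1 ∧ ∃ i ∈ S, sg n p + 2 * i + 1 = n) := by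
    constructor
    · rintro ⟨i, hi, h⟩
      have := (chord_iff hn hodd p q i p.2 q.2 (hS i hi)).1 h
      exact ⟨this.1, i, hi, this.2⟩
    · rintro ⟨h, i, hi, h'⟩
      exact ⟨i, hi, (chord_iff hn hodd p q i p.2 q.2 (hS i hi)).2 ⟨h, h'⟩⟩
  have c2 : (∃ i ∈ S, q.val = i ∧ p.val = n - i) ↔
      (sg n p = sg n q + 1 ∧ ∃ i ∈ S, sg n q + 2 * i + 1 = n) := by
    constructor
    · rintro ⟨i, hi, h⟩
      have := (chord_iff hn hodd q p i q.2 p.2 (hS i hi)).1 h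
      exact ⟨this.1, i, hi, this.2⟩
    · rintro ⟨h, i, hi, h'⟩
      exact ⟨i, hi, (chord_iff hn hodd q p i q.2 p.2 (hS i hi)).2 ⟨h, h'⟩⟩
  rw [c1, c2]
  clear c1 c2 hadj
  rcases lt_or_gt_of_ne hsne with h | h
  · rw [hsh _ _ h hsq]
    constructor
    · rintro (h1 | h1 | h1 | h1)
      · exact Or.inl (Or.inl ⟨h, Or.inl h1⟩)
      · exact Or.inl (Or.inl ⟨h, Or.inr (Or.inl h1)⟩)
      · exact Or.inl (Or.inl ⟨h, Or.inr (Or.inr h1)⟩)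
      · exact Or.inr (Or.inl h1)
    · rintro ((⟨_, h1 | h1 | h1⟩ | ⟨h1, _⟩) | h1 | ⟨h1, _⟩)
      · exact Or.inl h1
      · exact Or.inr (Or.inl h1)
      · exact Or.inr (Or.inr (Or.inl h1))
      · omega
      · exact Or.inr (Or.inr (Or.inr h1))
      · omega
  · rw [hsymm, hsh _ _ h hsp]
    constructor
    · rintro (h1 | h1 | h1 | h1)
      · exact Or.inl (Or.inr ⟨h, Or.inl h1⟩)
      · exact Or.inl (Or.inr ⟨h, Or.inr (Or.inl h1)⟩)
      · exact Or.inl (Or.inr ⟨h, Or.inr (Or.inr h1)⟩)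
      · exact Or.inr (Or.inr h1)
    · rintro ((⟨h1, _⟩ | ⟨_, h1 | h1 | h1⟩) | ⟨h1, _⟩ | h1)
      · omega
      · exact Or.inl h1
      · exact Or.inr (Or.inl h1)
      · exact Or.inr (Or.inr (Or.inl h1))
      · omega
      · exact Or.inr (Or.inr (Or.inr h1))

lemma H_empty (n : ℕ) : Hgraph n ∅ = cycleG n := by
  ext p q
  simp [Hgraph]

end Trans


section Final

/-- relation of the folded cycle -/
def TR (n p q : ℕ) : Prop := q = p + 2 ∨ (p = 0 ∧ q = 1) ∨ (p + 2 = n ∧ q + 1 = n)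

/-- folded cycle -/
def Tg (n : ℕ) : SimpleGraph (Fin n) := SimpleGraph.fromRel (fun p q => TR n p.val q.val)

lemma An_Tg {n : ℕ} (hn : 3 ≤ n) (p q : ℕ) :
    An (Tg n) (Equiv.refl _) p q ↔ p < n ∧ q < n ∧ (TR n p q ∨ TR n q p) := by
  simp only [An, Tg, SimpleGraph.fromRel_adj, Equiv.refl_apply, ne_eq, Fin.mk.injEq, exists_prop]
  constructor
  · rintro ⟨a, b, -, c⟩; exact ⟨a, b, c⟩
  · rintro ⟨a, b, c⟩
    refine ⟨a, b, ?_, c⟩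
    unfold TR at c
    omega

lemma shape_Tg {n : ℕ} (hn : 3 ≤ n) : Shape n ∅ (An (Tg n) (Equiv.refl _)) := by
  intro p q hpq hq
  rw [An_Tg hn]
  simp only [Finset.notMem_empty, false_and, exists_false, and_false, or_false, TR]
  omega

lemma least_Tg {n : ℕ} (hn : 3 ≤ n) (hodd : n % 2 = 1) : leastQEig (Tg n) = leastQEig (cycleG n) := by
  obtain ⟨f⟩ := iso_of_shape hn hodd (Tg n) (Equiv.refl _) ∅ (by simp) (shape_Tg hn)
  rw [least_iso _ _ f, H_empty]

/-- signs -/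
def sn (i : ℕ) : ℝ := (-1) ^ ((i + 1) / 2)

lemma sn_sq (i : ℕ) : sn i * sn i = 1 := by
  rw [sn, ← pow_add, ← two_mul, pow_mul]; norm_num

lemma sn_two (i : ℕ) : sn (i + 2) = - sn i := by
  rw [sn, sn, show (i + 2 + 1) / 2 = (i + 1) / 2 + 1 by omega, pow_succ]; ring

lemma sn_zero : sn 0 = 1 := by simp [sn]

lemma sn_one : sn 1 = -1 := by simp [sn]

lemma sn_last {n : ℕ} (hn : 3 ≤ n) (hodd : n % 2 = 1) : sn (n - 2) = sn (n - 1) := by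
  rw [sn, sn, show (n - 2 + 1) / 2 = (n - 1 + 1) / 2 by omega]

lemma En_Tg {n : ℕ} (hn : 3 ≤ n) (hodd : n % 2 = 1) (a z : ℕ → ℝ) (hz : ∀ i, i < n → z i = sn i * a i) :
    En n (An (Tg n) (Equiv.refl _)) z ≤ ET n a := by
  have hsub : PE n (An (Tg n) (Equiv.refl _)) ⊆ insert (0, 1) (insert (n - 2, n - 1)
      ((Finset.range (n - 2)).image (fun i => (i, i + 2)))) := by
    rintro ⟨p, q⟩ he
    simp only [PE, Finset.mem_filter, Finset.mem_product, Finset.mem_range] at he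
    obtain ⟨⟨h1, h2⟩, h3, h4⟩ := he
    rw [An_Tg hn] at h4
    obtain ⟨-, -, h5⟩ := h4
    simp only [Finset.mem_insert, Finset.mem_image, Finset.mem_range, Prod.mk.injEq]
    unfold TR at h5
    rcases (by omega : q = p + 2 ∨ (p = 0 ∧ q = 1) ∨ (p + 2 = n ∧ q + 1 = n)) with h | h | h
    · exact Or.inr (Or.inr ⟨p, by omega, rfl, h.symm⟩)
    · exact Or.inl h
    · exact Or.inr (Or.inl (by omega))
  refine (Finset.sum_le_sum_of_subset_of_nonneg hsub fun e _ _ => sq_nonneg _).trans ?_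
  rw [Finset.sum_insert, Finset.sum_insert, Finset.sum_image]
  · have h1 : (z 0 + z 1) ^ 2 = (a 0 - a 1) ^ 2 := by
      rw [hz 0 (by omega), hz 1 (by omega), sn_zero, sn_one]; ring
    have h2 : (z (n - 2) + z (n - 1)) ^ 2 = (a (n - 2) + a (n - 1)) ^ 2 := by
      rw [hz _ (by omega), hz _ (by omega), sn_last hn hodd]
      linear_combination (a (n - 2) + a (n - 1)) ^ 2 * sn_sq (n - 1)
    have h3 : ∑ i ∈ Finset.range (n - 2), (z i + z (i + 2)) ^ 2 =
        ∑ i ∈ Finset.range (n - 2), (a i - a (i + 2)) ^ 2 := by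
      refine Finset.sum_congr rfl fun i hi => ?_
      rw [Finset.mem_range] at hi
      rw [hz _ (by omega), hz _ (by omega), sn_two]
      linear_combination (a i - a (i + 2)) ^ 2 * sn_sq i
    simp only [ET]
    rw [h1, h2, h3]
    linarith
  · intro i _ j _ h
    simpa using h
  · simp only [Finset.mem_image, Finset.mem_range, Prod.mk.injEq, not_exists, not_and]
    omega
  · intro h
    simp only [Finset.mem_insert, Finset.mem_image, Finset.mem_range, Prod.mk.injEq] at h
    rcases h with h | ⟨i, h, h3, h4⟩ <;> omega

def lo (p : ℕ) : ℕ := if p = 0 then 1 else if p = 1 then 0 else p - 2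

def hi' (n p : ℕ) : ℕ := if p + 1 = n then n - 2 else if p + 2 = n then n - 1 else p + 2

lemma lo_ne_hi {n : ℕ} (hn : 3 ≤ n) (p : ℕ) (hp : p < n) : lo p ≠ hi' n p := by
  intro h
  unfold lo hi' at h
  split_ifs at h <;> omega

lemma recur {n : ℕ} (hn : 3 ≤ n) (hodd : n % 2 = 1) (a : ℕ → ℝ) (q : ℝ) (z : Fin n → ℝ)
    (hz : ∀ i : Fin n, z i = sn i * a i)
    (he : (signlessLaplacian (Tg n)).mulVec z = q • z) (p : ℕ) (hp : p < n) :
    (2 - q) * a p = a (lo p) + (if p + 2 < n then a (p + 2) else - a (hi' n p)) := by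
  have h1 := congrFun he ⟨p, hp⟩
  rw [sl_mulVec] at h1
  have hl : lo p < n := by unfold lo; split_ifs <;> omega
  have hh : hi' n p < n := by unfold hi'; split_ifs <;> omega
  have hadj : ∀ r : Fin n, (Tg n).Adj ⟨p, hp⟩ r ↔ r ∈ ({⟨lo p, hl⟩, ⟨hi' n p, hh⟩} : Finset (Fin n)) := by
    intro r
    have h2 := An_val (Tg n) (Equiv.refl _) ⟨p, hp⟩ r
    rw [An_Tg hn] at h2
    simp only [Equiv.refl_apply] at h2
    rw [← h2]
    have := r.2
    simp only [Finset.mem_insert, Finset.mem_singleton, Fin.ext_iff, TR, lo, hi']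
    split_ifs <;> omega
  simp only [hadj] at h1
  rw [← Finset.sum_filter, Finset.filter_mem_eq_inter, Finset.univ_inter, Finset.sum_pair (by
    intro h
    exact lo_ne_hi hn p hp (Fin.mk.inj h))] at h1
  simp only [hz, Pi.smul_apply, smul_eq_mul] at h1
  have hlo : sn (lo p) = - sn p := by
    unfold lo
    split_ifs with h2 h3
    · rw [h2, sn_zero, sn_one]
    · rw [h3, sn_zero, sn_one]; ring
    · have := sn_two (p - 2)
      rw [show p - 2 + 2 = p by omega] at this
      rw [this]; ring
  rw [hlo] at h1
  have hsq := sn_sq p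
  split_ifs with h2
  · have : hi' n p = p + 2 := by unfold hi'; split_ifs <;> omega
    rw [this, sn_two] at h1
    linear_combination (sn p) * h1 - ((2 - q) * a p - a (lo p) - a (p + 2)) * hsq
  · have : sn (hi' n p) = sn p := by
      have h4 := sn_last hn hodd
      unfold hi'
      split_ifs with h5 h6
      · rw [h4]; congr 1; omega
      · rw [← h4]; congr 1; omega
      · omega
    rw [this] at h1
    linear_combination (sn p) * h1 - ((2 - q) * a p - a (lo p) + a (hi' n p)) * hsq

lemma zprop {n : ℕ} {a : ℕ → ℝ} (hn : 3 ≤ n) (c : ℝ) (hanti : Antitone a)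
    (h0 : ∀ i, n ≤ i → a i = 0)
    (hrec : ∀ p, p < n → c * a p = a (lo p) + (if p + 2 < n then a (p + 2) else - a (hi' n p)))
    (i : ℕ) (hi : i + 2 < n) : a i = a (i + 1) ↔ a (i + 2) = a (i + 3) := by
  have hnn : ∀ j, 0 ≤ a j := fun j => by
    rw [← h0 (n + j) (by omega)]; exact hanti (by omega)
  constructor
  · intro h
    have e1 := hrec i (by omega)
    have e2 := hrec (i + 1) (by omega)
    rw [if_pos hi] at e1
    have hd : a (lo (i + 1)) ≤ a (lo i) := by
      rcases (by omega : i = 0 ∨ i = 1 ∨ 2 ≤ i) with rfl | rfl | h2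
      · simp [lo]; exact h.le
      · simp [lo]
      · have : lo i ≤ lo (i + 1) := by
          rw [lo, lo, if_neg (by omega), if_neg (by omega), if_neg (by omega), if_neg (by omega)]
          omega
        exact hanti this
    rw [← h, e1] at e2
    have m := hanti (show i + 2 ≤ i + 3 by omega)
    by_cases h3 : i + 3 < n
    · rw [if_pos (by omega), show i + 1 + 2 = i + 3 by ring] at e2
      linarith
    · rw [if_neg (by omega), show hi' n (i + 1) = i + 2 by unfold hi'; split_ifs <;> omega] at e2
      have := hnn (i + 2)
      rw [h0 (i + 3) (by omega)]
      linarith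
  · intro h
    have e1 := hrec (i + 2) (by omega)
    have m := hanti (show i ≤ i + 1 by omega)
    rw [show lo (i + 2) = i by simp [lo]] at e1
    by_cases h3 : i + 3 < n
    · have e2 := hrec (i + 3) (by omega)
      rw [show lo (i + 3) = i + 1 by simp [lo]] at e2
      rw [← h, e1] at e2
      by_cases h4 : i + 4 < n
      · rw [if_pos (by omega)] at e2
        by_cases h5 : i + 5 < n
        · rw [if_pos (by omega)] at e2
          have := hanti (show i + 2 + 2 ≤ i + 3 + 2 by omega)
          linarith
        · rw [if_neg (by omega), show hi' n (i + 3) = i + 2 + 2 by unfold hi'; split_ifs <;> omega] at e2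
          have := hnn (i + 2 + 2)
          linarith
      · rw [if_neg (by omega), if_neg (by omega), 
          show hi' n (i + 2) = i + 3 by unfold hi'; split_ifs <;> omega,
          show hi' n (i + 3) = i + 2 by unfold hi'; split_ifs <;> omega] at e2
        linarith
    · rw [if_neg (by omega), h, h0 (i + 3) (by omega),
        show hi' n (i + 2) = i + 1 by unfold hi'; split_ifs <;> omega] at e1
      linarith

lemma swap_val {n g : ℕ} (h : g + 1 < n) (i : Fin n) :
    ((Equiv.swap (⟨g, by omega⟩ : Fin n) ⟨g + 1, h⟩ i : Fin n) : ℕ) = Equiv.swap g (g + 1) i.val := by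
  simp only [Equiv.swap_apply_def, Fin.ext_iff]
  split_ifs <;> rfl

lemma swap_lt {n g : ℕ} (h : g + 1 < n) (i : ℕ) : Equiv.swap g (g + 1) i < n ↔ i < n := by
  rw [Equiv.swap_apply_def]
  split_ifs <;> omega

end Final

lemma srt_exists {V : Type*} [Fintype V] {n : ℕ} (hcard : Fintype.card V = n) (x : V → ℝ) :
    ∃ w : Fin n ≃ V, Antitone (fun i : ℕ => |xn x w i|) := by
  let e0 := (Fintype.equivFinOfCardEq hcard).symm
  have hm := Tuple.monotone_sort (fun i => -|x (e0 i)|)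
  refine ⟨(Tuple.sort (fun i => -|x (e0 i)|)).trans e0, ?_⟩
  intro i j hij
  by_cases hj : j < n
  · have := hm (show (⟨i, by omega⟩ : Fin n) ≤ ⟨j, hj⟩ from hij)
    simp only [Function.comp_apply, neg_le_neg_iff] at this
    simpa [xn, hj, lt_of_le_of_lt hij hj] using this
  · simp [xn, hj]

theorem stmt9 (n : ℕ) (hn : 3 ≤ n) (hodd : Odd n) {V : Type*} [Fintype V]
    (G : SimpleGraph V) (hcard : Fintype.card V = n)
    (h2 : TwoConnected G) (hnb : ¬ G.Colorable 2)
    (heq : leastQEig G = leastQEig (cycleG n)) :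
    Nonempty (G ≃g cycleG n) ∨
      ∃ S : Finset ℕ, S.Nonempty ∧ (∀ i ∈ S, 1 ≤ i ∧ i ≤ (n - 3) / 2) ∧
        Nonempty (G ≃g Hgraph n S) := by
  have hodd' : n % 2 = 1 := Nat.odd_iff.1 hodd
  haveI : Nonempty V := Fintype.card_pos_iff.1 (by omega)
  obtain ⟨x, hx0, hx⟩ := eig_exists G
  obtain ⟨w0, hanti⟩ := srt_exists hcard x
  obtain ⟨a, ha⟩ : ∃ a : ℕ → ℝ, ∀ i, a i = |xn x w0 i| := ⟨_, fun _ => rfl⟩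
  rw [← funext ha] at hanti
  have h0 : ∀ i, n ≤ i → a i = 0 := fun i hi => by
    rw [ha, xn, dif_neg (by omega), abs_zero]
  have hnn : ∀ i, 0 ≤ a i := fun i => by rw [ha]; exact abs_nonneg _
  have hne : a 0 ≠ 0 := by
    intro h
    apply hx0
    funext v
    have h3 := hanti (Nat.zero_le ((w0.symm v : Fin n) : ℕ))
    rw [h, ha, xn_val, Equiv.apply_symm_apply] at h3
    exact abs_eq_zero.1 (le_antisymm h3 (abs_nonneg _))
  have hxx : x ⬝ᵥ x = ∑ i : Fin n, a i * a i := by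
    rw [dotProduct, ← Equiv.sum_comp w0]
    refine Finset.sum_congr rfl fun i _ => ?_
    rw [ha, xn_val, abs_mul_abs_self]
  obtain ⟨z, hz⟩ : ∃ z : Fin n → ℝ, ∀ i : Fin n, z i = sn i * a i := ⟨_, fun _ => rfl⟩
  have hzz : z ⬝ᵥ z = ∑ i : Fin n, a i * a i := by
    rw [dotProduct]
    refine Finset.sum_congr rfl fun i _ => ?_
    rw [hz]
    linear_combination (a i * a i) * sn_sq i
  have hqT := (least_Tg hn hodd').trans heq.symm
  have hT1 := rayleigh_le (Tg n) z
  have hT2 : z ⬝ᵥ (signlessLaplacian (Tg n)).mulVec z ≤ ET n a := by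
    rw [quad_En (Tg n) (Equiv.refl _) z]
    refine En_Tg hn hodd' a _ fun i hi => ?_
    have := xn_val z (Equiv.refl _) ⟨i, hi⟩
    rw [Equiv.refl_apply, hz] at this
    exact this
  have hG : x ⬝ᵥ (signlessLaplacian G).mulVec x = leastQEig G * (x ⬝ᵥ x) := by
    rw [hx, dotProduct_smul, smul_eq_mul]
  have hsrt : ∀ w : Fin n ≃ V, (∀ i, |xn x w i| = a i) → Srt n (xn x w) a :=
    fun w hw => ⟨fun i => (hw i).symm, hanti, h0⟩
  have hle := ET_le (gd_of hn G w0 h2 hnb) (hsrt w0 fun i => (ha i).symm)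
  rw [← quad_En, hG, hxx] at hle
  rw [hqT, hzz] at hT1
  have hTe : (signlessLaplacian (Tg n)).mulVec z = leastQEig (Tg n) • z := by
    apply rayleigh_eq
    rw [hqT, hzz]
    exact le_antisymm (hT2.trans hle) hT1
  have hrec := recur hn hodd' a _ z hz hTe
  have hzp := zprop hn _ hanti h0 hrec
  obtain ⟨A, ⟨w, rfl, -⟩, S, hS, hsh⟩ := comb hodd'
    (fun A => ∃ w : Fin n ≃ V, A = An G w ∧ ∀ i, |xn x w i| = a i) (by
      rintro A ⟨w, rfl, hw⟩
      refine ⟨gd_of hn G w h2 hnb, xn x w, facts (gd_of hn G w h2 hnb) (hsrt w hw) ?_⟩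
      rw [← quad_En, hG, hxx]
      exact hT1.trans hT2) (by
      rintro A ⟨w, rfl, hw⟩ g hg hag
      refine ⟨(Equiv.swap (⟨g, by omega⟩ : Fin n) ⟨g + 1, hg⟩).trans w, ?_, ?_⟩
      · funext i j
        apply propext
        by_cases hi : i < n
        · by_cases hj : j < n
          · have e1 := An_val G ((Equiv.swap (⟨g, by omega⟩ : Fin n) ⟨g + 1, hg⟩).trans w) ⟨i, hi⟩ ⟨j, hj⟩
            have e2 := An_val G w (Equiv.swap (⟨g, by omega⟩ : Fin n) ⟨g + 1, hg⟩ ⟨i, hi⟩)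
              (Equiv.swap (⟨g, by omega⟩ : Fin n) ⟨g + 1, hg⟩ ⟨j, hj⟩)
            rw [swap_val, swap_val] at e2
            exact e2.trans e1.symm
          · constructor
            · rintro ⟨_, h, _⟩; exact absurd ((swap_lt hg j).1 h) hj
            · rintro ⟨_, h, _⟩; exact absurd h hj
        · constructor
          · rintro ⟨h, _, _⟩; exact absurd ((swap_lt hg i).1 h) hi
          · rintro ⟨h, _, _⟩; exact absurd h hi
      · intro i
        have has : a (Equiv.swap g (g + 1) i) = a i := by
          rw [Equiv.swap_apply_def]
          split_ifs with h3 h4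
          · rw [h3, hag]
          · rw [h4, hag]
          · rfl
        by_cases hi : i < n
        · have e1 := xn_val x ((Equiv.swap (⟨g, by omega⟩ : Fin n) ⟨g + 1, hg⟩).trans w) ⟨i, hi⟩
          have e2 := xn_val x w (Equiv.swap (⟨g, by omega⟩ : Fin n) ⟨g + 1, hg⟩ ⟨i, hi⟩)
          rw [swap_val] at e2
          rw [← has, ← hw]
          exact congrArg _ (e1.trans e2.symm)
        · rw [xn, dif_neg hi, abs_zero, h0 i (by omega)])
    hanti h0 hne hzp (An G w0) ⟨w0, rfl, fun i => (ha i).symm⟩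
  have hiso := iso_of_shape hn hodd' G w S hS hsh
  rcases S.eq_empty_or_nonempty with rfl | hne'
  · left
    rwa [H_empty] at hiso
  · exact Or.inr ⟨S, hne', hS, hiso⟩
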